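/- Let m ≥ 2, n ≥ 1, 0 ≤ ℓ ≤ m, and Λ = (n,…,n,0,…,0) ∈ ℤ^m with ℓ entries equal to n. Let ū = w̄ be the explosion (each entry repeated n times) of the concatenation, for s = ℓ, ℓ−1, …, 1 in this order, of the blocks (s, s+1, …, s+m−ℓ−1); so ū has length n·ℓ·(m−ℓ). Then ⟪ū,ū⟫ = ([n]!)^{2ℓ(m−ℓ)}. Equivalently, the scaled closed formula evaluates the trivial (all-phantom) web paired with itself to 1. (The sequence (ℓ^{(n)},…,(m−1)^{(n)},(ℓ−1)^{(n)},…,(m−2)^{(n)},…,1^{(n)},…,(m−ℓ)^{(n)}) is the residue sequence of the trivial web from (n^ℓ,0,…,0) to (0,…,0,n^ℓ).) -/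

import Mathlib

open LaurentPolynomial Finset

noncomputable section

/-- The quantum integer `[a] = q^(a-1) + q^(a-3) + ⋯ + q^(-a+1)` for `a ≥ 0`,
with `[a] = -[-a]` for `a < 0`. -/
def qint (a : ℤ) : LaurentPolynomial ℤ :=
  if 0 ≤ a then ∑ i ∈ Finset.range a.toNat, T (a - 1 - 2 * i)
  else - ∑ i ∈ Finset.range (-a).toNat, T (-a - 1 - 2 * i)

/-- The quantum factorial `[b]! = [b][b-1]⋯[1]`. -/
def qfac (b : ℕ) : LaurentPolynomial ℤ :=
  ∏ i ∈ Finset.range b, qint (i + 1)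

/-- The simple root `α_i = e_i - e_{i+1} ∈ ℤ^m` (with `1 ≤ i ≤ m-1`, one-indexed
entries realized on `Fin m`). -/
def simpleRoot (m i : ℕ) : Fin m → ℤ :=
  fun j => (if (j : ℕ) + 1 = i then 1 else 0) - (if (j : ℕ) = i then 1 else 0)

/-- The standard dot product on `ℤ^m`. -/
def dotP {m : ℕ} (v w : Fin m → ℤ) : ℤ := ∑ j, v j * w j

/-- The highest weight `Λ = (n,…,n,0,…,0)` with `ℓ` entries equal to `n`. -/
def LambdaVec (m n ℓ : ℕ) : Fin m → ℤ := fun j => if (j : ℕ) < ℓ then (n : ℤ) else 0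

/-- `N^Λ(σ, ū, t) = ⟨Λ - ∑_{j ≤ t, σ(j) < σ(t)} α_{ū_j}, α_{ū_t}⟩`. -/
def Nwt {m N : ℕ} (Λ : Fin m → ℤ) (σ : Equiv.Perm (Fin N)) (u : Fin N → ℕ) (t : Fin N) : ℤ :=
  dotP (Λ - ∑ j ∈ Finset.univ.filter (fun j => j ≤ t ∧ σ j < σ t), simpleRoot m (u j))
    (simpleRoot m (u t))

/-- `X_σ = ∏_t [N^Λ(σ,ū,t)]·q^(N^Λ(e,ū,t) - 1)`. -/
def Xsig {m N : ℕ} (Λ : Fin m → ℤ) (σ : Equiv.Perm (Fin N)) (u : Fin N → ℕ) :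
    LaurentPolynomial ℤ :=
  ∏ t : Fin N, qint (Nwt Λ σ u t) * T (Nwt Λ 1 u t - 1)

/-- The set of possible crossings `S_ū^w̄ = {σ : ū_j = w̄_{σ(j)} for all j}`. -/
def Sset {N : ℕ} (u w : Fin N → ℕ) : Finset (Equiv.Perm (Fin N)) :=
  Finset.univ.filter fun σ => ∀ j, u j = w (σ j)

/-- The evaluation `⟪ū, w̄⟫ = ∑_{σ ∈ S_ū^w̄} X_σ`. -/
def pairing {m N : ℕ} (Λ : Fin m → ℤ) (u w : Fin N → ℕ) : LaurentPolynomial ℤ :=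
  ∑ σ ∈ Sset u w, Xsig Λ σ u


abbrev LR := LaurentPolynomial ℤ
abbrev St := ℕ → Bool

def swp (i : ℕ) (b : St) : St := fun p => b (Equiv.swap i (i + 1) p)
def upS (i : ℕ) (b : St) : Prop := b i = true ∧ b (i + 1) = false
def dnS (i : ℕ) (b : St) : Prop := b i = false ∧ b (i + 1) = true

instance (i : ℕ) (b : St) : Decidable (upS i b) := inferInstanceAs (Decidable (_ ∧ _))
instance (i : ℕ) (b : St) : Decidable (dnS i b) := inferInstanceAs (Decidable (_ ∧ _))

def bv (x : Bool) : ℤ := if x then 1 else 0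
def hS (i : ℕ) (b : St) : ℤ := bv (b i) - bv (b (i + 1))

/-- The Cartan matrix. -/
def Acar (i j : ℕ) : ℤ := if i = j then 2 else if i = j + 1 ∨ j = i + 1 then -1 else 0

lemma Acar_comm (i j : ℕ) : Acar i j = Acar j i := by
  unfold Acar
  split_ifs <;> first | rfl | omega

lemma swp_apply (i : ℕ) (b : St) (p : ℕ) :
    swp i b p = if p = i then b (i + 1) else if p = i + 1 then b i else b p := by
  unfold swp
  rw [Equiv.swap_apply_def]
  split_ifs <;> rfl

lemma swp_swp (i : ℕ) (b : St) : swp i (swp i b) = b := by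
  funext p; simp [swp]

lemma up_swp (i : ℕ) (b : St) : upS i (swp i b) ↔ dnS i b := by
  simp [upS, dnS, swp, and_comm]

lemma dn_swp (i : ℕ) (b : St) : dnS i (swp i b) ↔ upS i b := by
  simp [upS, dnS, swp, and_comm]

lemma hS_up {i : ℕ} {b : St} (h : upS i b) : hS i b = 1 := by
  simp [hS, h.1, h.2, bv]

lemma hS_dn {i : ℕ} {b : St} (h : dnS i b) : hS i b = -1 := by
  simp [hS, h.1, h.2, bv]

lemma hS_none {i : ℕ} {b : St} (h : ¬ upS i b) (h' : ¬ dnS i b) : hS i b = 0 := by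
  unfold upS dnS at *
  unfold hS bv
  cases h1 : b i <;> cases h2 : b (i + 1) <;> simp_all

lemma hS_swp_up (i j : ℕ) {b : St} (h : upS i b) : hS j (swp i b) = hS j b - Acar i j := by
  obtain ⟨h1, h2⟩ := h
  unfold hS Acar
  rw [swp_apply, swp_apply]
  by_cases e1 : i = j
  · subst e1; simp [h1, h2, bv]
  by_cases e2 : i = j + 1
  · have q1 : j ≠ j + 1 + 1 := by omega
    subst e2; simp [h1, h2, bv, q1]
  by_cases e3 : j = i + 1
  · have q1 : i + 1 + 1 ≠ i := by omega
    subst e3; simp [h1, h2, bv, q1]; ring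
  · have : j ≠ i := fun h => e1 h.symm
    have : j + 1 ≠ i := fun h => e2 h.symm
    simp [*]

lemma hS_swp_dn (i j : ℕ) {b : St} (h : dnS i b) : hS j (swp i b) = hS j b + Acar i j := by
  have := hS_swp_up i j ((up_swp i b).2 h)
  rw [swp_swp] at this
  omega

lemma cross_iff {i j : ℕ} (hij : i ≠ j) (b : St) :
    (upS i b ∧ dnS j (swp i b)) ↔ (dnS j b ∧ upS i (swp j b)) := by
  unfold upS dnS
  simp only [swp_apply]
  by_cases e2 : i = j + 1
  · subst e2; simp; grind
  by_cases e3 : j = i + 1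
  · subst e3; simp; grind
  · have : j ≠ i := fun h => hij h.symm
    have : j + 1 ≠ i := fun h => e2 h.symm
    have : i + 1 ≠ j := fun h => e3 h.symm
    simp [*]
    tauto

lemma cross_eq {i j : ℕ} (hij : i ≠ j) {b : St} (h : upS i b ∧ dnS j (swp i b)) :
    swp j (swp i b) = swp i (swp j b) := by
  obtain ⟨⟨h1, h2⟩, h3, h4⟩ := h
  rw [swp_apply] at h3 h4
  by_cases e2 : i = j + 1
  · exfalso; subst e2; grind
  by_cases e3 : j = i + 1
  · exfalso; subst e3; grind
  funext p
  simp only [swp_apply]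
  grind

/-- Representation data. -/
structure IsRep (M : Type) [AddCommGroup M] [Module LR M] (E F K Ki : ℕ → M →ₗ[LR] M)
    (x : St → M) (n : ℕ) : Prop where
  tf : ∀ y : M, ((T 1 - T (-1) : LR)) • y = 0 → y = 0
  KKi : ∀ i y, K i (Ki i y) = y
  KiK : ∀ i y, Ki i (K i y) = y
  KK : ∀ i j y, K i (K j y) = K j (K i y)
  KE : ∀ i j y, K i (E j y) = (T (Acar i j) : LR) • E j (K i y)
  KF : ∀ i j y, K i (F j y) = (T (-Acar i j) : LR) • F j (K i y)
  EF : ∀ i y, (T 1 - T (-1) : LR) • (E i (F i y) - F i (E i y)) = K i y - Ki i y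
  EFne : ∀ i j y, i ≠ j → E i (F j y) = F j (E i y)
  xK : ∀ i b, K i (x b) = (T (n * hS i b) : LR) • x b
  xE : ∀ i b, ¬ dnS i b → E i (x b) = 0
  xF : ∀ i b, upS i b → (F i)^[n] (x b) = qfac n • x (swp i b)
  xFz : ∀ i b, upS i b → (F i)^[n + 1] (x b) = 0
  xEd : ∀ i b, dnS i b → (E i)^[n] (x b) = qfac n • x (swp i b)
  xEz : ∀ i b, dnS i b → (E i)^[n + 1] (x b) = 0
  inj : ∀ b (r : LR), r • x b = 0 → r = 0

lemma T_ne : (T 1 - T (-1) : LR) ≠ 0 := by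
  intro h
  have h2 := sub_eq_zero.1 h
  have h3 := congrArg LaurentPolynomial.degree h2
  simp at h3

lemma qint_mul (a : ℤ) : (T 1 - T (-1) : LR) * qint a = T a - T (-a) := by
  have key : ∀ k : ℕ, (T 1 - T (-1) : LR) * ∑ i ∈ Finset.range k, T ((k : ℤ) - 1 - 2 * i)
      = T k - T (-k) := by
    intro k
    have : ∀ k' : ℕ, (T 1 - T (-1) : LR) * ∑ i ∈ Finset.range k', T ((k : ℤ) - 1 - 2 * i)
      = T k - T (k - 2 * k') := by
      intro k'
      induction k' with
      | zero => simp
      | succ r ih =>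
        rw [Finset.sum_range_succ, mul_add, ih, sub_mul, ← T_add, ← T_add]
        push_cast
        ring_nf
    rw [this]; ring_nf
  unfold qint
  split_ifs with h
  · obtain ⟨k, rfl⟩ := Int.eq_ofNat_of_zero_le h
    simpa using key k
  · obtain ⟨k, hk⟩ := Int.eq_ofNat_of_zero_le (show 0 ≤ -a by omega)
    obtain rfl : a = -k := by omega
    have := key k
    simp only [neg_neg, Int.toNat_natCast, mul_neg, this]
    ring

lemma isRep_zero : IsRep LR (fun _ => 0) (fun _ => 0) (fun _ => LinearMap.id)
    (fun _ => LinearMap.id) (fun _ => 1) 0 where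
  tf y hy := by
    have := mul_eq_zero.1 hy
    exact this.resolve_left T_ne
  KKi := by simp
  KiK := by simp
  KK := by simp
  KE := by simp
  KF := by simp
  EF := by simp
  EFne := by simp
  xK := by simp
  xE := by simp
  xF := by simp [qfac]
  xFz := by simp
  xEd := by simp [qfac]
  xEz := by simp
  inj := by simp

section tensor

variable {M : Type} [AddCommGroup M] [Module LR M] 

def tF (F : ℕ → M →ₗ[LR] M) (i : ℕ) : (St → M) →ₗ[LR] (St → M) where
  toFun f := fun b => (T (-hS i b) : LR) • F i (f b) + if dnS i b then f (swp i b) else 0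
  map_add' f g := by
    funext b
    simp only [Pi.add_apply, map_add, smul_add]
    split_ifs <;> abel
  map_smul' r f := by
    funext b
    simp only [Pi.smul_apply, map_smul, RingHom.id_apply, smul_add, smul_ite, smul_zero]
    rw [smul_comm]

def tE (E K : ℕ → M →ₗ[LR] M) (i : ℕ) : (St → M) →ₗ[LR] (St → M) where
  toFun f := fun b => E i (f b) + if upS i b then K i (f (swp i b)) else 0
  map_add' f g := by
    funext b
    simp only [Pi.add_apply, map_add]
    split_ifs <;> abel
  map_smul' r f := by
    funext b
    simp only [Pi.smul_apply, map_smul, RingHom.id_apply, smul_add, smul_ite, smul_zero]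

def tK (K : ℕ → M →ₗ[LR] M) (i : ℕ) : (St → M) →ₗ[LR] (St → M) where
  toFun f := fun b => (T (hS i b) : LR) • K i (f b)
  map_add' f g := by
    funext b
    simp only [Pi.add_apply, map_add, smul_add]
  map_smul' r f := by
    funext b
    simp only [Pi.smul_apply, map_smul, RingHom.id_apply]
    rw [smul_comm]

def tKi (Ki : ℕ → M →ₗ[LR] M) (i : ℕ) : (St → M) →ₗ[LR] (St → M) where
  toFun f := fun b => (T (-hS i b) : LR) • Ki i (f b)
  map_add' f g := by
    funext b
    simp only [Pi.add_apply, map_add, smul_add]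
  map_smul' r f := by
    funext b
    simp only [Pi.smul_apply, map_smul, RingHom.id_apply]
    rw [smul_comm]

open Classical in
def sg (b : St) (y : M) : St → M := fun b' => if b' = b then y else 0

lemma T_smul_smul (a c : ℤ) (y : M) : (T a : LR) • (T c : LR) • y = (T (a + c) : LR) • y := by
  rw [smul_smul, ← T_add]

lemma sg_smul (b : St) (r : LR) (y : M) : sg b (r • y) = r • sg b y := by
  funext b'
  simp [sg]

set_option linter.unusedSectionVars false in
lemma sg_zero (b : St) : sg b (0 : M) = 0 := by
  funext b'
  simp [sg]

lemma swp_eq_iff (i : ℕ) (b b' : St) : swp i b' = b ↔ b' = swp i b := by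
  constructor
  · rintro rfl; rw [swp_swp]
  · rintro rfl; rw [swp_swp]

lemma tF_sg (F : ℕ → M →ₗ[LR] M) (i : ℕ) (b : St) (y : M) :
    tF F i (sg b y) = (T (-hS i b) : LR) • sg b (F i y) + if upS i b then sg (swp i b) y else 0 := by
  funext b'
  have e : (if dnS i b' then sg b y (swp i b') else 0)
      = (if upS i b then sg (swp i b) y else 0 : St → M) b' := by
    by_cases h : b' = swp i b
    · subst h
      simp only [dn_swp, swp_swp]
      split_ifs <;> simp [sg]
    · have : sg b y (swp i b') = 0 := by
        simp [sg, swp_eq_iff, h]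
      rw [this]
      split_ifs <;> simp [sg, h]
  show _ + (if dnS i b' then sg b y (swp i b') else 0) = _
  rw [e, Pi.add_apply]
  congr 1
  by_cases h : b' = b
  · subst h; simp [sg]
  · simp [sg, h]

lemma tE_sg (E K : ℕ → M →ₗ[LR] M) (i : ℕ) (b : St) (y : M) :
    tE E K i (sg b y) = sg b (E i y) + if dnS i b then sg (swp i b) (K i y) else 0 := by
  funext b'
  have e : (if upS i b' then K i (sg b y (swp i b')) else 0)
      = (if dnS i b then sg (swp i b) (K i y) else 0 : St → M) b' := by
    by_cases h : b' = swp i b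
    · subst h
      simp only [up_swp, swp_swp]
      split_ifs <;> simp [sg]
    · have : sg b y (swp i b') = 0 := by
        simp [sg, swp_eq_iff, h]
      rw [this]
      split_ifs <;> simp [sg, h]
  show _ + (if upS i b' then K i (sg b y (swp i b')) else 0) = _
  rw [e, Pi.add_apply]
  congr 1
  by_cases h : b' = b
  · subst h; simp [sg]
  · simp [sg, h]

lemma tK_sg (K : ℕ → M →ₗ[LR] M) (i : ℕ) (b : St) (y : M) :
    tK K i (sg b y) = (T (hS i b) : LR) • sg b (K i y) := by
  funext b'
  show (T (hS i b') : LR) • K i (sg b y b') = _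
  by_cases h : b' = b
  · subst h; simp [sg]
  · simp [sg, h]

lemma not_up_of_dn {i : ℕ} {b : St} (h : dnS i b) : ¬ upS i b := by
  rintro ⟨h1, h2⟩
  simp [dnS, h1] at h

lemma not_dn_of_up {i : ℕ} {b : St} (h : upS i b) : ¬ dnS i b :=
  fun h' => not_up_of_dn h' h

lemma qint_succ (k : ℕ) : qint ((k : ℤ) + 2) = T (-((k : ℤ) + 1)) + T 1 * qint ((k : ℤ) + 1) := by
  apply mul_left_cancel₀ T_ne
  rw [mul_add, mul_left_comm, qint_mul, qint_mul]
  simp only [sub_mul, mul_sub, ← T_add]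
  ring_nf

lemma qint_one : qint 1 = 1 := by simp [qint]

lemma tF_iter (F : ℕ → M →ₗ[LR] M) (i : ℕ) (b : St) (hb : upS i b) (y : M) (k : ℕ) :
    (tF F i)^[k + 1] (sg b y) = (T (-((k : ℤ) + 1)) : LR) • sg b ((F i)^[k + 1] y)
      + qint ((k : ℤ) + 1) • sg (swp i b) ((F i)^[k] y) := by
  induction k with
  | zero =>
    simp [tF_sg, hb, hS_up hb, qint_one]
  | succ k ih =>
    rw [Function.iterate_succ_apply', ih, map_add, map_smul, map_smul, tF_sg, tF_sg, if_pos hb,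
      if_neg (by rw [up_swp]; exact not_dn_of_up hb), hS_up hb, hS_dn ((dn_swp i b).2 hb),
      ← Function.iterate_succ_apply' (F i), ← Function.iterate_succ_apply' (F i)]
    push_cast
    rw [show ((k : ℤ) + 1 + 1) = (k : ℤ) + 2 by ring, qint_succ]
    rw [add_zero, smul_add, T_smul_smul, smul_smul, add_smul, mul_comm (qint _),
      add_assoc]
    congr 3

/-- Partial sums. -/
def dsum (n k : ℕ) : LR := ∑ r ∈ Finset.range k, T (-(n : ℤ) + 2 * r)

lemma dsum_eq (n : ℕ) : dsum n (n + 1) = qint ((n : ℤ) + 1) := by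
  have : ∀ k : ℕ, (T 1 - T (-1) : LR) * dsum n k = T (-(n : ℤ) + 2 * k - 1) - T (-(n : ℤ) - 1) := by
    intro k
    induction k with
    | zero => simp [dsum]
    | succ k ih =>
      unfold dsum at ih ⊢
      rw [Finset.sum_range_succ, mul_add, ih, sub_mul, ← T_add, ← T_add]
      push_cast
      ring_nf
  apply mul_left_cancel₀ T_ne
  rw [this, qint_mul]
  push_cast
  ring_nf

lemma tE_iter {E F K Ki : ℕ → M →ₗ[LR] M} {x : St → M} {n : ℕ} (H : IsRep M E F K Ki x n)
    (i : ℕ) (b : St) (hb : dnS i b) (k : ℕ) :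
    (tE E K i)^[k + 1] (sg b (x b)) = sg b ((E i)^[k + 1] (x b))
      + dsum n (k + 1) • sg (swp i b) ((E i)^[k] (x b)) := by
  have hK : ∀ k : ℕ, K i ((E i)^[k] (x b)) = (T (-(n : ℤ) + 2 * k) : LR) • (E i)^[k] (x b) := by
    intro k
    induction k with
    | zero => simp [H.xK, hS_dn hb]
    | succ k ih =>
      rw [Function.iterate_succ_apply', H.KE, ih, map_smul, T_smul_smul]
      congr 2
      simp [Acar]; ring
  induction k with
  | zero =>
    have := hK 0
    simp only [Function.iterate_zero, id] at this
    simp [tE_sg, hb, dsum, this, sg_smul]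
  | succ k ih =>
    rw [Function.iterate_succ_apply', ih, map_add, map_smul, tE_sg, tE_sg, if_pos hb,
      if_neg (by rw [dn_swp]; exact not_up_of_dn hb), hK,
      ← Function.iterate_succ_apply' (E i), ← Function.iterate_succ_apply' (E i)]
    rw [dsum, dsum, Finset.sum_range_succ _ (k + 1), add_smul, sg_smul, add_zero, add_assoc]
    congr 1
    rw [add_comm]

lemma qfac_succ (n : ℕ) : qfac (n + 1) = qint ((n : ℤ) + 1) * qfac n := by
  rw [qfac, Finset.prod_range_succ, mul_comm]; rfl

lemma isRep_succ {E F K Ki : ℕ → M →ₗ[LR] M} {x : St → M} {n : ℕ} (H : IsRep M E F K Ki x n) :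
    IsRep (St → M) (tE E K) (tF F) (tK K) (tKi Ki) (fun b => sg b (x b)) (n + 1) where
  tf y hy := by
    funext b
    exact H.tf _ (congrFun hy b)
  KKi i y := by
    funext b
    show (T _ : LR) • K i ((T _ : LR) • Ki i (y b)) = y b
    rw [map_smul, T_smul_smul, H.KKi]; simp
  KiK i y := by
    funext b
    show (T _ : LR) • Ki i ((T _ : LR) • K i (y b)) = y b
    rw [map_smul, T_smul_smul, H.KiK]; simp
  KE i j y := by
    funext b
    show (T (hS i b) : LR) • K i (E j (y b) + if upS j b then K j (y (swp j b)) else 0) =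
      (T (Acar i j) : LR) • (E j ((T (hS i b) : LR) • K i (y b)) +
        if upS j b then K j ((T (hS i (swp j b)) : LR) • K i (y (swp j b))) else 0)
    rw [map_add, H.KE, map_smul]
    simp only [smul_add, T_smul_smul]
    congr 1
    · congr 2; ring
    · split_ifs with h
      · rw [hS_swp_up j i h, map_smul, T_smul_smul, Acar_comm j i, H.KK i j]; congr 2; ring
      · simp
  KK i j y := by
    funext b
    show (T _ : LR) • K i ((T _ : LR) • K j (y b)) = (T _ : LR) • K j ((T _ : LR) • K i (y b))
    rw [map_smul, map_smul, T_smul_smul, T_smul_smul, H.KK i j, add_comm]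
  KF i j y := by
    funext b
    show (T (hS i b) : LR) • K i ((T (-hS j b) : LR) • F j (y b) + if dnS j b then (y (swp j b)) else 0) =
      (T (-Acar i j) : LR) • ((T (-hS j b) : LR) • F j ((T (hS i b) : LR) • K i (y b)) +
        if dnS j b then ((T (hS i (swp j b)) : LR) • K i (y (swp j b))) else 0)
    rw [map_add, H.KF |> fun h => map_smul (K i) _ _, H.KF, map_smul]
    simp only [smul_add, T_smul_smul]
    congr 1
    · congr 2; ring
    · split_ifs with h
      · rw [hS_swp_dn j i h, T_smul_smul, Acar_comm j i]; congr 2; ring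
      · simp
  EF i y := by
    funext b
    show (T 1 - T (-1) : LR) • ((E i ((T (-hS i b) : LR) • F i (y b) + if dnS i b then y (swp i b) else 0)
        + if upS i b then K i ((T (-hS i (swp i b)) : LR) • F i (y (swp i b)) +
          if dnS i (swp i b) then y (swp i (swp i b)) else 0) else 0) -
      ((T (-hS i b) : LR) • F i (E i (y b) + if upS i b then K i (y (swp i b)) else 0) +
        if dnS i b then (E i (y (swp i b)) + if upS i (swp i b) then K i (y (swp i (swp i b))) else 0)
          else 0)) = (T (hS i b) : LR) • K i (y b) - (T (-hS i b) : LR) • Ki i (y b)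
    have e := H.EF i (y b)
    simp only [dn_swp, up_swp, swp_swp]
    have e' : Ki i (y b) = K i (y b) - (T 1 - T (-1) : LR) • (E i (F i (y b)) - F i (E i (y b))) := by
      rw [e]; abel
    rw [e']
    by_cases hu : upS i b
    · have hd := not_dn_of_up hu
      simp only [hu, hd, if_true, if_false, hS_up hu, hS_dn ((dn_swp i b).2 hu), add_zero, map_add,
        map_smul, H.KF, T_smul_smul, neg_neg]
      rw [show (1 : ℤ) + -Acar i i = -1 by simp [Acar]]
      module
    · by_cases hd : dnS i b
      · simp only [hu, hd, if_true, if_false, hS_dn hd, add_zero, map_add,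
          map_smul, neg_neg]
        module
      · simp only [hu, hd, if_false, hS_none hu hd, add_zero, map_smul, neg_zero, T_zero, one_smul]
        module
  EFne i j y hij := by
    funext b
    show (E i ((T (-hS j b) : LR) • F j (y b) + if dnS j b then y (swp j b) else 0)
        + if upS i b then K i ((T (-hS j (swp i b)) : LR) • F j (y (swp i b)) +
          if dnS j (swp i b) then y (swp j (swp i b)) else 0) else 0) =
      ((T (-hS j b) : LR) • F j (E i (y b) + if upS i b then K i (y (swp i b)) else 0) +
        if dnS j b then (E i (y (swp j b)) + if upS i (swp j b) then K i (y (swp i (swp j b))) else 0)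
          else 0)
    have c1 : (if upS i b then K i ((T (-hS j (swp i b)) : LR) • F j (y (swp i b)) +
          if dnS j (swp i b) then y (swp j (swp i b)) else 0) else 0)
        = (if upS i b then (T (-hS j b) : LR) • F j (K i (y (swp i b))) else 0) +
          if upS i b ∧ dnS j (swp i b) then K i (y (swp j (swp i b))) else 0 := by
      by_cases hu : upS i b
      · simp only [hu, if_true, true_and, map_add, map_smul, H.KF, T_smul_smul, hS_swp_up i j hu]
        congr 1
        · congr 2; ring
        · split_ifs <;> simp
      · simp [hu]
    have c2 : (if dnS j b then (E i (y (swp j b)) + if upS i (swp j b) then K i (y (swp i (swp j b))) else 0)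
          else 0) = (if dnS j b then E i (y (swp j b)) else 0) +
          if upS i b ∧ dnS j (swp i b) then K i (y (swp j (swp i b))) else 0 := by
      have : (if upS i b ∧ dnS j (swp i b) then K i (y (swp j (swp i b))) else 0) =
          if dnS j b ∧ upS i (swp j b) then K i (y (swp i (swp j b))) else 0 := by
        by_cases h : upS i b ∧ dnS j (swp i b)
        · rw [if_pos h, if_pos ((cross_iff hij b).1 h), cross_eq hij h]
        · rw [if_neg h, if_neg (fun h' => h ((cross_iff hij b).2 h'))]
      rw [this]
      by_cases hd : dnS j b <;> simp [hd]
    rw [c1, c2]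
    simp only [map_add, map_smul, H.EFne i j _ hij, smul_add]
    split_ifs <;> (try simp only [map_zero, smul_zero]) <;> abel
  xK i b := by
    rw [tK_sg, H.xK, sg_smul, T_smul_smul]
    congr 2
    push_cast; ring
  xE i b h := by
    rw [tE_sg, H.xE i b h, if_neg h, sg_zero, add_zero]
  xF i b h := by
    rw [tF_iter F i b h, H.xFz i b h, H.xF i b h, sg_zero, smul_zero, zero_add, sg_smul, smul_smul,
      qfac_succ]
  xFz i b h := by
    rw [tF_iter F i b h, H.xFz i b h, Function.iterate_succ_apply', H.xFz i b h]
    simp [sg_zero]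
  xEd i b h := by
    rw [tE_iter H i b h, H.xEz i b h, H.xEd i b h, sg_zero, zero_add, sg_smul, smul_smul,
      qfac_succ, dsum_eq]
  xEz i b h := by
    rw [tE_iter H i b h, H.xEz i b h, Function.iterate_succ_apply', H.xEz i b h]
    simp [sg_zero]
  inj b r h := by
    have := congrFun h b
    exact H.inj b r (by simpa [sg] using this)

end tensor

lemma exists_rep (n : ℕ) : ∃ (M : Type) (_ : AddCommGroup M) (_ : Module LR M)
    (E F K Ki : ℕ → M →ₗ[LR] M) (x : St → M), IsRep M E F K Ki x n := by
  induction n with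
  | zero => exact ⟨_, _, _, _, _, _, _, _, isRep_zero⟩
  | succ n ih =>
    obtain ⟨M, i1, i2, E, F, K, Ki, x, H⟩ := ih
    exact ⟨_, _, _, _, _, _, _, _, isRep_succ H⟩

section words

variable {M : Type} [AddCommGroup M] [Module LR M]

def Fw (F : ℕ → M →ₗ[LR] M) (v : M) : (N : ℕ) → (Fin N → ℕ) → M
  | 0, _ => v
  | N + 1, w => F (w (Fin.last N)) (Fw F v N (fun j => w j.castSucc))

def Ew (E : ℕ → M →ₗ[LR] M) : (N : ℕ) → (Fin N → ℕ) → M →ₗ[LR] M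
  | 0, _ => LinearMap.id
  | N + 1, u => (Ew E N (fun j => u j.castSucc)).comp (E (u (Fin.last N)))

variable {E F K Ki : ℕ → M →ₗ[LR] M} {x : St → M} {n : ℕ}

lemma EF_weight (H : IsRep M E F K Ki x n) (i : ℕ) (y : M) (a : ℤ)
    (hy : K i y = (T a : LR) • y) : E i (F i y) = F i (E i y) + qint a • y := by
  have hKi : Ki i y = (T (-a) : LR) • y := by
    have h := H.KiK i y
    rw [hy, map_smul] at h
    rw [← h, T_smul_smul, h]
    simp
  have h := H.EF i y
  rw [hy, hKi, ← sub_smul, ← qint_mul a, mul_smul, ← sub_eq_zero, ← smul_sub] at h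
  have := H.tf _ h
  rw [sub_eq_zero, sub_eq_iff_eq_add] at this
  rw [this, add_comm]

lemma Fw_weight (H : IsRep M E F K Ki x n) (Λ : ℕ → ℤ) (v : M)
    (hv : ∀ i, K i v = (T (Λ i) : LR) • v) (N : ℕ) (w : Fin N → ℕ) (i : ℕ) :
    K i (Fw F v N w) = (T (Λ i - ∑ j, Acar (w j) i) : LR) • Fw F v N w := by
  induction N with
  | zero => simp [Fw, hv]
  | succ N ih =>
    rw [Fw, H.KF, ih, map_smul, T_smul_smul, Fin.sum_univ_castSucc, Acar_comm i]
    congr 2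
    ring

lemma E_Fw (H : IsRep M E F K Ki x n) (Λ : ℕ → ℤ) (v : M)
    (hv : ∀ i, K i v = (T (Λ i) : LR) • v) (hE : ∀ i, E i v = 0)
    (N : ℕ) (w : Fin (N + 1) → ℕ) (i : ℕ) :
    E i (Fw F v (N + 1) w) = ∑ k : Fin (N + 1), if i = w k then
      qint (Λ i - ∑ j, if j < k then Acar (w j) i else 0) •
        Fw F v N (fun j => w (k.succAbove j)) else 0 := by
  have step : ∀ (N : ℕ) (w : Fin (N + 1) → ℕ),
      E i (Fw F v (N + 1) w) = F (w (Fin.last N)) (E i (Fw F v N (fun j => w j.castSucc))) +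
        if i = w (Fin.last N) then qint (Λ i - ∑ j : Fin N, Acar (w j.castSucc) i) •
          Fw F v N (fun j => w j.castSucc) else 0 := by
    intro N w
    rw [Fw]
    split_ifs with h
    · rw [← h]
      exact EF_weight H i _ _ (Fw_weight H Λ v hv N _ i)
    · rw [H.EFne _ _ _ h, add_zero]
  induction N with
  | zero =>
    rw [step]
    simp [Fw, hE]
  | succ N ih =>
    rw [step, ih, map_sum]
    conv_rhs => rw [Fin.sum_univ_castSucc]
    congr 1
    · refine Finset.sum_congr rfl fun k _ => ?_
      split_ifs with h
      · rw [map_smul]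
        conv_rhs => rw [Fin.sum_univ_castSucc]
        congr 1
        · simp [Fin.castSucc_lt_castSucc_iff, (Fin.castSucc_lt_last k).not_gt]
        · show _ = F (w (k.castSucc.succAbove (Fin.last N)))
            (Fw F v N fun j => w (k.castSucc.succAbove j.castSucc))
          rw [Fin.succAbove_of_le_castSucc k.castSucc (Fin.last N)
            (Fin.castSucc_le_castSucc_iff.2 (Fin.le_last k)), Fin.succ_last]
          simp only [Fin.castSucc_succAbove_castSucc]
      · simp
    · simp [Fin.sum_univ_castSucc (n := N + 1), Fin.castSucc_lt_last]

end words

def insP {N : ℕ} (p : Fin (N + 1) × Equiv.Perm (Fin N)) : Equiv.Perm (Fin (N + 1)) :=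
  finSuccEquivLast.trans ((Equiv.optionCongr p.2).trans (finSuccEquiv' p.1).symm)

lemma insP_last {N : ℕ} (p : Fin (N + 1) × Equiv.Perm (Fin N)) : insP p (Fin.last N) = p.1 := by
  simp [insP]

lemma insP_castSucc {N : ℕ} (p : Fin (N + 1) × Equiv.Perm (Fin N)) (j : Fin N) :
    insP p j.castSucc = p.1.succAbove (p.2 j) := by
  simp [insP]

lemma insP_bij (N : ℕ) : Function.Bijective (@insP N) := by
  rw [Fintype.bijective_iff_injective_and_card]
  constructor
  · rintro ⟨k, τ⟩ ⟨k', τ'⟩ h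
    have h1 : k = k' := by
      have := congrArg (fun σ => σ (Fin.last N)) h
      simpa [insP_last] using this
    subst h1
    congr 1
    ext j
    have := congrArg (fun σ => σ j.castSucc) h
    simp only [insP_castSucc] at this
    rw [Fin.succAbove_right_injective this]
  · simp [Fintype.card_perm, Nat.factorial_succ]

/-- The quantity `N(σ,u,t)` with the Cartan matrix. -/
def Dw (Λ : ℕ → ℤ) {N : ℕ} (σ : Equiv.Perm (Fin N)) (u : Fin N → ℕ) (t : Fin N) : ℤ :=
  Λ (u t) - ∑ j, if j ≤ t ∧ σ j < σ t then Acar (u j) (u t) else 0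

def Pf (Λ : ℕ → ℤ) (N : ℕ) (u w : Fin N → ℕ) : LR :=
  ∑ σ : Equiv.Perm (Fin N), if (∀ j, u j = w (σ j)) then ∏ t, qint (Dw Λ σ u t) else 0

lemma Pf_succ (Λ : ℕ → ℤ) (N : ℕ) (u w : Fin (N + 1) → ℕ) :
    Pf Λ (N + 1) u w = ∑ k : Fin (N + 1), if u (Fin.last N) = w k then
      qint (Λ (u (Fin.last N)) - ∑ j, if j < k then Acar (w j) (u (Fin.last N)) else 0) *
        Pf Λ N (fun j => u j.castSucc) (fun j => w (k.succAbove j)) else 0 := by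
  rw [Pf, ← (Equiv.ofBijective _ (insP_bij N)).sum_comp, Fintype.sum_prod_type]
  refine Finset.sum_congr rfl fun k _ => ?_
  simp only [Equiv.ofBijective_apply, Fin.forall_fin_succ', insP_last, insP_castSucc]
  split_ifs with h
  · rw [Pf, Finset.mul_sum]
    refine Finset.sum_congr rfl fun τ _ => ?_
    by_cases h2 : ∀ j : Fin N, u j.castSucc = w (k.succAbove (τ j))
    · rw [if_pos ⟨h2, h⟩, if_pos h2, Fin.prod_univ_castSucc, mul_comm]
      have e1 : Dw Λ (insP (k, τ)) u (Fin.last N) = Λ (u (Fin.last N)) -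
          ∑ j, if j < k then Acar (w j) (u (Fin.last N)) else 0 := by
        rw [Dw, insP_last]
        congr 1
        rw [← Equiv.sum_comp (insP (k, τ)) (fun j => if j < k then Acar (w j) (u (Fin.last N)) else 0)]
        refine Finset.sum_congr rfl fun j _ => ?_
        have : u j = w (insP (k, τ) j) := by
          induction j using Fin.lastCases with
          | last => rw [insP_last]; exact h
          | cast j => rw [insP_castSucc]; exact h2 j
        rw [this]
        simp [Fin.le_last]
      rw [e1]
      congr 1
      refine Finset.prod_congr rfl fun t _ => ?_
      congr 1
      rw [Dw, Dw, Fin.sum_univ_castSucc]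
      simp only [insP_castSucc, Fin.castSucc_le_castSucc_iff, (Fin.castSucc_lt_last t).not_ge,
        false_and, if_false, add_zero, Fin.succAbove_lt_succAbove_iff]
    · rw [if_neg (fun h' => h2 h'.1), if_neg h2, mul_zero]
  · exact Finset.sum_eq_zero fun τ _ => if_neg (fun h' => h h'.2)

lemma Ew_Fw {M : Type} [AddCommGroup M] [Module LR M]
    {E F K Ki : ℕ → M →ₗ[LR] M} {x : St → M} {n : ℕ}
    (H : IsRep M E F K Ki x n) (Λ : ℕ → ℤ) (v : M)
    (hv : ∀ i, K i v = (T (Λ i) : LR) • v) (hE : ∀ i, E i v = 0)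
    (N : ℕ) (u w : Fin N → ℕ) :
    Ew E N u (Fw F v N w) = Pf Λ N u w • v := by
  induction N with
  | zero => simp [Ew, Fw, Pf]
  | succ N ih =>
    rw [Pf_succ, Ew, LinearMap.comp_apply, E_Fw H Λ v hv hE, map_sum, Finset.sum_smul]
    refine Finset.sum_congr rfl fun k _ => ?_
    split_ifs with h
    · rw [map_smul, ih, mul_smul]
    · simp

lemma Fw_list {M : Type} [AddCommGroup M] [Module LR M] (F : ℕ → M →ₗ[LR] M) (v : M)
    (N : ℕ) (u : Fin N → ℕ) : Fw F v N u = (List.ofFn u).foldl (fun y i => F i y) v := by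
  induction N with
  | zero => simp [Fw]
  | succ N ih => rw [Fw, ih, List.ofFn_succ']; simp

lemma Ew_list {M : Type} [AddCommGroup M] [Module LR M] (E : ℕ → M →ₗ[LR] M) (y : M)
    (N : ℕ) (u : Fin N → ℕ) : Ew E N u y = (List.ofFn u).foldr (fun i y => E i y) y := by
  induction N generalizing y with
  | zero => simp [Ew]
  | succ N ih => rw [Ew, LinearMap.comp_apply, ih, List.ofFn_succ']; simp

def validC : St → List ℕ → Prop
  | _, [] => True
  | b, c :: l => upS c b ∧ validC (swp c b) l

def endC : St → List ℕ → St
  | b, [] => b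
  | b, c :: l => endC (swp c b) l

lemma endC_append (b : St) (l l' : List ℕ) : endC b (l ++ l') = endC (endC b l) l' := by
  induction l generalizing b with
  | nil => rfl
  | cons c l ih => exact ih _

lemma validC_append (b : St) (l l' : List ℕ) :
    validC b (l ++ l') ↔ validC b l ∧ validC (endC b l) l' := by
  induction l generalizing b with
  | nil => simp [validC, endC]
  | cons c l ih => simp [validC, endC, ih, and_assoc]

section chain

variable {M : Type} [AddCommGroup M] [Module LR M]
    {E F K Ki : ℕ → M →ₗ[LR] M} {x : St → M} {n : ℕ}

lemma iter_smul (G : M →ₗ[LR] M) (k : ℕ) (r : LR) (y : M) : G^[k] (r • y) = r • G^[k] y := by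
  induction k generalizing y with
  | zero => rfl
  | succ k ih => rw [Function.iterate_succ_apply, map_smul, ih, Function.iterate_succ_apply]

lemma foldl_smul (G : ℕ → M →ₗ[LR] M) (l : List ℕ) (r : LR) (y : M) :
    l.foldl (fun y i => G i y) (r • y) = r • l.foldl (fun y i => G i y) y := by
  induction l generalizing y with
  | nil => rfl
  | cons c l ih => simp only [List.foldl_cons, map_smul, ih]

lemma foldl_rep (G : ℕ → M →ₗ[LR] M) (k c : ℕ) (y : M) :
    (List.replicate k c).foldl (fun y i => G i y) y = (G c)^[k] y := by
  induction k generalizing y with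
  | zero => rfl
  | succ k ih => rw [List.replicate_succ, List.foldl_cons, ih, Function.iterate_succ_apply]

lemma foldr_rep (G : ℕ → M →ₗ[LR] M) (k c : ℕ) (y : M) :
    (List.replicate k c).foldr (fun i y => G i y) y = (G c)^[k] y := by
  induction k with
  | zero => rfl
  | succ k ih => rw [List.replicate_succ, List.foldr_cons, ih, Function.iterate_succ_apply']

lemma foldl_chain (H : IsRep M E F K Ki x n) (l : List ℕ) (b : St) (h : validC b l) :
    (l.flatMap fun c => List.replicate n c).foldl (fun y i => F i y) (x b)
      = qfac n ^ l.length • x (endC b l) := by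
  induction l generalizing b with
  | nil => simp [endC]
  | cons c l ih =>
    rw [List.flatMap_cons, List.foldl_append, foldl_rep, H.xF c b h.1, foldl_smul, ih _ h.2,
      smul_smul, List.length_cons, pow_succ']
    rfl

lemma foldr_chain (H : IsRep M E F K Ki x n) (l : List ℕ) (b : St) (h : validC b l) :
    (l.flatMap fun c => List.replicate n c).foldr (fun i y => E i y) (x (endC b l))
      = qfac n ^ l.length • x b := by
  induction l generalizing b with
  | nil => simp [endC]
  | cons c l ih =>
    rw [List.flatMap_cons, List.foldr_append, foldr_rep, endC, ih _ h.2, iter_smul,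
      H.xEd c _ ((dn_swp c b).2 h.1), swp_swp, smul_smul, List.length_cons, pow_succ]

lemma foldr_smul (G : ℕ → M →ₗ[LR] M) (l : List ℕ) (r : LR) (y : M) :
    l.foldr (fun i y => G i y) (r • y) = r • l.foldr (fun i y => G i y) y := by
  induction l with
  | nil => rfl
  | cons c l ih => simp only [List.foldr_cons, map_smul, ih]

end chain

lemma Pf_chain (n : ℕ) (l : List ℕ) (b : St) (hb : ∀ i, ¬ dnS i b) (h : validC b l)
    (N : ℕ) (u : Fin N → ℕ) (hu : List.ofFn u = l.flatMap fun c => List.replicate n c) :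
    Pf (fun i => n * hS i b) N u u = qfac n ^ (2 * l.length) := by
  obtain ⟨M, i1, i2, E, F, K, Ki, x, H⟩ := exists_rep n
  have e := Ew_Fw H (fun i => n * hS i b) (x b) (fun i => H.xK i b) (fun i => H.xE i b (hb i)) N u u
  rw [Fw_list, Ew_list, hu, foldl_chain H l b h, foldr_smul, foldr_chain H l b h, smul_smul,
    ← sub_eq_zero, ← sub_smul] at e
  have := H.inj b _ e
  rw [sub_eq_zero] at this
  rw [← this, two_mul, pow_add]

def ws : (ℕ → ℤ) → List ℕ → ℤ
  | _, [] => 0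
  | Λ, c :: l => (Λ c - 1) + ws (fun i => Λ i - Acar c i) l

lemma ws_ofFn (Λ : ℕ → ℤ) (N : ℕ) (u : Fin N → ℕ) :
    ∑ t, (Dw Λ 1 u t - 1) = ws Λ (List.ofFn u) := by
  induction N generalizing Λ with
  | zero => simp [ws]
  | succ N ih =>
    rw [List.ofFn_succ, ws, ← ih, Fin.sum_univ_succ]
    congr 1
    · congr 1
      rw [Dw, sub_eq_self]
      apply Finset.sum_eq_zero
      intro j _
      rw [if_neg]
      simp
    · refine Finset.sum_congr rfl fun t _ => ?_
      simp only [Dw, Fin.sum_univ_succ, Equiv.Perm.coe_one, id, Fin.succ_le_succ_iff,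
        Fin.succ_lt_succ_iff, Fin.zero_le, Fin.succ_pos, and_self, if_true]
      ring_nf
      rfl

lemma ws_rep (Λ : ℕ → ℤ) (k c : ℕ) (l : List ℕ) : ws Λ (List.replicate k c ++ l) =
    k * (Λ c - 1) - k * (k - 1) + ws (fun i => Λ i - k * Acar c i) l := by
  induction k generalizing Λ with
  | zero => simp
  | succ k ih =>
    rw [List.replicate_succ, List.cons_append, ws, ih]
    have : (fun i => Λ i - Acar c i - k * Acar c i) = fun i => Λ i - ((k + 1 : ℕ) : ℤ) * Acar c i := by
      funext i; push_cast; ring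
    rw [this]
    have : Acar c c = 2 := by simp [Acar]
    rw [this]
    push_cast
    ring

lemma ws_chain (n : ℕ) (l : List ℕ) (b : St) (h : validC b l) :
    ws (fun i => n * hS i b) (l.flatMap fun c => List.replicate n c) = 0 := by
  induction l generalizing b with
  | nil => rfl
  | cons c l ih =>
    rw [List.flatMap_cons, ws_rep, hS_up h.1]
    have : (fun i => (n : ℤ) * hS i b - n * Acar c i) = fun i => n * hS i (swp c b) := by
      funext i; rw [hS_swp_up c i h.1]; ring
    rw [this, ih _ h.2]
    ring

def stS (m d s j : ℕ) : St := fun p => decide (p < s ∨ p = s + j ∨ (s + d < p ∧ p ≤ m))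

lemma row_valid (m d s r : ℕ) (hr : r ≤ d) :
    validC (stS m d s 0) ((List.range r).map fun j => s + j) ∧
      endC (stS m d s 0) ((List.range r).map fun j => s + j) = stS m d s r := by
  induction r with
  | zero => simp [validC, endC]
  | succ r ih =>
    obtain ⟨h1, h2⟩ := ih (by omega)
    rw [List.range_succ, List.map_append, validC_append, endC_append, h2]
    refine ⟨⟨h1, ?_⟩, ?_⟩
    · refine ⟨⟨?_, ?_⟩, trivial⟩
      · simp [stS]
      · simp only [stS, decide_eq_false_iff_not]; omega
    · show swp (s + r) (stS m d s r) = _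
      funext p
      rw [swp_apply]
      simp only [stS]
      split_ifs <;> rw [decide_eq_decide] <;> (try simp only [true_or, or_true, true_iff]) <;> omega

def rowsL (d ℓ : ℕ) : List ℕ :=
  ((List.range ℓ).map fun i => ℓ - i).flatMap fun s => (List.range d).map fun j => s + j

lemma rows_succ (d ℓ : ℕ) :
    rowsL d (ℓ + 1) = ((List.range d).map fun j => (ℓ + 1) + j) ++ rowsL d ℓ := by
  unfold rowsL
  rw [List.range_succ_eq_map, List.map_cons, List.map_map, List.flatMap_cons]
  congr 2
  apply List.map_congr_left
  intro a _
  simp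

lemma rows_valid (m d ℓ : ℕ) (h : ℓ + d ≤ m) : validC (stS m d ℓ 0) (rowsL d ℓ) := by
  induction ℓ with
  | zero => simp [rowsL, validC]
  | succ ℓ ih =>
    obtain ⟨h1, h2⟩ := row_valid m d (ℓ + 1) d le_rfl
    rw [rows_succ, validC_append, h2]
    refine ⟨h1, ?_⟩
    have : stS m d (ℓ + 1) d = stS m d ℓ 0 := by
      funext p
      simp only [stS]
      rw [decide_eq_decide]; omega
    rw [this]
    exact ih (by omega)

lemma rows_length (d ℓ : ℕ) : (rowsL d ℓ).length = ℓ * d := by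
  induction ℓ with
  | zero => simp [rowsL]
  | succ ℓ ih => rw [rows_succ, List.length_append, ih]; simp; ring

lemma dotP_root {m : ℕ} (v : Fin m → ℤ) (k : ℕ) (hk : k + 1 < m) :
    dotP v (simpleRoot m (k + 1)) = v ⟨k, by omega⟩ - v ⟨k + 1, hk⟩ := by
  unfold dotP simpleRoot
  simp only [mul_sub, Finset.sum_sub_distrib, mul_ite, mul_one, mul_zero]
  congr 1
  · rw [Finset.sum_eq_single ⟨k, by omega⟩]
    · simp
    · intro b _ hb
      rw [if_neg]
      intro h; apply hb; ext; simp; omega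
    · simp
  · rw [Finset.sum_eq_single ⟨k + 1, hk⟩]
    · simp
    · intro b _ hb
      rw [if_neg]
      intro h; apply hb; ext; simp; omega
    · simp

lemma root_root {m i k : ℕ} (hi : 1 ≤ i) (hk : k + 1 < m) :
    dotP (simpleRoot m i) (simpleRoot m (k + 1)) = Acar i (k + 1) := by
  rw [dotP_root _ k hk]
  unfold simpleRoot Acar
  simp only
  split_ifs <;> omega

lemma Nwt_eq (m n ℓ d : ℕ) (hm : ℓ + d = m) {N : ℕ} (σ : Equiv.Perm (Fin N)) (u : Fin N → ℕ)
    (hu : ∀ t, 1 ≤ u t ∧ u t < m) (t : Fin N) :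
    Nwt (LambdaVec m n ℓ) σ u t = Dw (fun i => n * hS i (stS m d ℓ 0)) σ u t := by
  obtain ⟨k, hk⟩ : ∃ k, u t = k + 1 := ⟨u t - 1, by have := hu t; omega⟩
  have hkm : k + 1 < m := hk ▸ (hu t).2
  have lin : ∀ (s : Finset (Fin N)) (v : Fin m → ℤ),
      dotP (v - ∑ j ∈ s, simpleRoot m (u j)) (simpleRoot m (k + 1)) =
        dotP v (simpleRoot m (k + 1)) - ∑ j ∈ s, Acar (u j) (k + 1) := by
    intro s v
    rw [dotP_root _ k hkm, dotP_root _ k hkm]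
    simp only [Pi.sub_apply, Finset.sum_apply]
    rw [show ∑ j ∈ s, Acar (u j) (k + 1) = ∑ j ∈ s,
      (simpleRoot m (u j) ⟨k, by omega⟩ - simpleRoot m (u j) ⟨k + 1, hkm⟩) from
      Finset.sum_congr rfl fun j _ => by rw [← root_root (hu j).1 hkm, dotP_root _ k hkm]]
    rw [Finset.sum_sub_distrib]
    ring
  unfold Nwt Dw
  rw [hk, lin, Finset.sum_filter]
  congr 1
  rw [dotP_root _ k hkm]
  unfold LambdaVec hS stS bv
  simp only [decide_eq_true_eq]
  split_ifs <;> omega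

lemma rows_mem (d ℓ c : ℕ) (h : c ∈ rowsL d ℓ) : 1 ≤ c ∧ c < ℓ + d := by
  simp only [rowsL, List.mem_flatMap, List.mem_map, List.mem_range] at h
  obtain ⟨s, ⟨i, hi, rfl⟩, j, hj, rfl⟩ := h
  omega

/-- The closed formula evaluates the trivial (all-phantom) web paired with itself
to `([n]!)^(2ℓ(m-ℓ))`: here `ū` is the `n`-fold explosion of the concatenation,
for `s = ℓ, ℓ-1, …, 1`, of the blocks `(s, s+1, …, s+m-ℓ-1)`. -/
theorem trivial_web_evaluation (m n ℓ : ℕ) (hm : 2 ≤ m) (hn : 1 ≤ n) (hℓ : ℓ ≤ m)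
    (u : Fin (n * ℓ * (m - ℓ)) → ℕ)
    (hu : List.ofFn u =
      (((List.range ℓ).map fun i => ℓ - i).flatMap fun s =>
          (List.range (m - ℓ)).map fun j => s + j).flatMap
        fun x => List.replicate n x) :
    pairing (LambdaVec m n ℓ) u u = (qfac n) ^ (2 * ℓ * (m - ℓ)) := by
  have hd : ℓ + (m - ℓ) = m := by omega
  have hu' : List.ofFn u = (rowsL (m - ℓ) ℓ).flatMap fun x => List.replicate n x := hu
  have hb : ∀ t, 1 ≤ u t ∧ u t < m := by
    intro t
    have h : u t ∈ List.ofFn u := by simp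
    rw [hu', List.mem_flatMap] at h
    obtain ⟨c, hc, h⟩ := h
    have := rows_mem _ _ _ hc
    rw [List.eq_of_mem_replicate h]
    omega
  have hval := rows_valid m (m - ℓ) ℓ hd.le
  have hdn : ∀ i, ¬ dnS i (stS m (m - ℓ) ℓ 0) := by
    rintro i ⟨h1, h2⟩
    simp only [stS, decide_eq_false_iff_not, decide_eq_true_eq] at h1 h2
    omega
  have hP := Pf_chain n _ _ hdn hval _ u hu'
  rw [rows_length, ← mul_assoc] at hP
  rw [← hP, pairing, Pf, Sset, Finset.sum_filter]
  refine Finset.sum_congr rfl fun σ _ => ?_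
  congr 1
  unfold Xsig
  simp only [Nwt_eq m n ℓ (m - ℓ) hd _ u hb]
  rw [Finset.prod_mul_distrib]
  have hT : ∀ (s : Finset (Fin (n * ℓ * (m - ℓ)))) (f : Fin (n * ℓ * (m - ℓ)) → ℤ),
      ∏ t ∈ s, (T (f t) : LR) = T (∑ t ∈ s, f t) := by
    intro s f
    induction s using Finset.cons_induction with
    | empty => simp
    | cons a s ha ih => rw [Finset.prod_cons, Finset.sum_cons, ih, T_add]
  rw [hT, ws_ofFn, hu', ws_chain n _ _ hval, T_zero, mul_one]

end
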